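/- In the braid group B_n, for positive integers m the element β_{n,m} = (δ δ^Δ)^{m−1} δ, where δ = a_1⋯a_{n−1} and δ^Δ = a_{n−1}⋯a_1, satisfies β_{n,m} = Δ^{2m−2} · (a_2⋯a_{n−1})^{−(m−1)(n−1)} · δ, where Δ² = δⁿ is the full twist. -/

import Mathlib

/-- The braid relations on `m` Artin generators: commutation for distant
generators and the braid relation for adjacent ones. -/
def braidRels (m : ℕ) : Set (FreeGroup (Fin m)) :=
  {r | (∃ i j : Fin m, (i : ℕ) + 2 ≤ (j : ℕ) ∧
        r = FreeGroup.of i * FreeGroup.of j * (FreeGroup.of i)⁻¹ * (FreeGroup.of j)⁻¹) ∨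
       (∃ i j : Fin m, (i : ℕ) + 1 = (j : ℕ) ∧
        r = FreeGroup.of i * FreeGroup.of j * FreeGroup.of i *
            (FreeGroup.of j * FreeGroup.of i * FreeGroup.of j)⁻¹)}

/-- The braid group on `m + 1` strands, with `m` Artin generators. -/
abbrev BraidGroup (m : ℕ) : Type := PresentedGroup (braidRels m)

/-- The Artin generator `a_{i+1}` of the braid group. -/
def σ {m : ℕ} (i : Fin m) : BraidGroup m := PresentedGroup.of i

section ArtinSequence

variable {G : Type*} [Group G] {a : ℕ → G} {k : ℕ}

/-- The product `a 0 * a 1 * ⋯ * a (j - 1)`. -/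
def ascProd (a : ℕ → G) (j : ℕ) : G := ((List.range j).map a).prod

/-- The product `a (j - 1) * ⋯ * a 1 * a 0`. -/
def descProd (a : ℕ → G) (j : ℕ) : G := ((List.range j).map a).reverse.prod

lemma ascProd_succ (a : ℕ → G) (j : ℕ) : ascProd a (j + 1) = ascProd a j * a j := by
  simp [ascProd, List.range_succ]

lemma ascProd_succ' (a : ℕ → G) (j : ℕ) :
    ascProd a (j + 1) = a 0 * ascProd (fun i => a (i + 1)) j := by
  simp [ascProd, List.range_succ_eq_map, Function.comp_def]

lemma descProd_succ (a : ℕ → G) (j : ℕ) : descProd a (j + 1) = a j * descProd a j := by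
  simp [descProd, List.range_succ]

/-- The first `k` terms of a sequence satisfy the braid relations. -/
structure IsArtinSequence (a : ℕ → G) (k : ℕ) : Prop where
  commute : ∀ i j, i + 2 ≤ j → j < k → Commute (a i) (a j)
  braid : ∀ i, i + 1 < k → a i * a (i + 1) * a i = a (i + 1) * a i * a (i + 1)

namespace IsArtinSequence

lemma commute_ascProd (h : IsArtinSequence a k) {j l : ℕ} (hjl : j + 1 ≤ l) (hl : l < k) :
    Commute (ascProd a j) (a l) := by
  refine Commute.list_prod_left _ _ fun x hx => ?_
  obtain ⟨i, hi, rfl⟩ := List.mem_map.1 hx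
  exact h.commute i l (by have := List.mem_range.1 hi; omega) hl

lemma semiconjBy_ascProd (h : IsArtinSequence a k) {i j : ℕ} (hij : i + 2 ≤ j) (hj : j ≤ k) :
    SemiconjBy (ascProd a j) (a i) (a (i + 1)) := by
  induction j, hij using Nat.le_induction with
  | base =>
    have hc := (h.commute_ascProd (le_refl (i + 1)) (by omega)).eq
    have hb := h.braid i (by omega)
    rw [SemiconjBy, ascProd_succ, ascProd_succ]
    calc ascProd a i * a i * a (i + 1) * a i
        = ascProd a i * (a i * a (i + 1) * a i) := by group
      _ = ascProd a i * a (i + 1) * (a i * a (i + 1)) := by rw [hb]; group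
      _ = a (i + 1) * (ascProd a i * a i * a (i + 1)) := by rw [hc]; group
  | succ j hij ih =>
    rw [ascProd_succ]
    exact (ih (by omega)).mul_left (h.commute i j hij (by omega)).symm

lemma semiconjBy_ascProd_pow (h : IsArtinSequence a k) {i j : ℕ} (hij : i + j < k) :
    SemiconjBy (ascProd a k ^ j) (a i) (a (i + j)) := by
  induction j with
  | zero => simp
  | succ j ih =>
    rw [pow_succ']
    exact (h.semiconjBy_ascProd (i := i + j) (by omega) le_rfl).mul_left (ih (by omega))

/-- For `δ = a 0 ⋯ a k`, the powers `δ ^ j` with `j ≤ k + 1` split off a descending product. -/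
lemma ascProd_pow (h : IsArtinSequence a (k + 1)) {j : ℕ} (hj : j ≤ k + 1) :
    ascProd a (k + 1) ^ j = descProd a j * ascProd (fun i => a (i + 1)) k ^ j := by
  induction j with
  | zero => simp [descProd]
  | succ j ih =>
    have hs := (h.semiconjBy_ascProd_pow (i := 0) (j := j) (by omega)).eq
    rw [zero_add] at hs
    rw [pow_succ]
    nth_rw 2 [ascProd_succ']
    rw [← mul_assoc, hs, ih (by omega), descProd_succ, pow_succ]
    simp only [mul_assoc]

lemma semiconjBy_ascProd_shift (h : IsArtinSequence a k) {j : ℕ} (hj : j < k) :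
    SemiconjBy (ascProd a k) (ascProd a j) (ascProd (fun i => a (i + 1)) j) := by
  induction j with
  | zero => simp [ascProd]
  | succ j ih =>
    rw [ascProd_succ, ascProd_succ]
    exact (ih (by omega)).mul_right (h.semiconjBy_ascProd (by omega) le_rfl)

lemma semiconjBy_ascProd_sq (h : IsArtinSequence a (k + 1)) :
    SemiconjBy (ascProd a (k + 1) ^ 2) (a k) (a 0) := by
  have hs : ascProd a (k + 1) ^ 2
      = ascProd (fun i => a (i + 1)) k * ascProd a (k + 1) * a k := by
    rw [← (h.semiconjBy_ascProd_shift k.lt_succ_self).eq, mul_assoc, ← ascProd_succ, sq]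
  calc ascProd a (k + 1) ^ 2 * a k
      = ascProd a (k + 1) * (ascProd a k * a k) * a k := by rw [← ascProd_succ, sq]
    _ = a 0 * ascProd (fun i => a (i + 1)) k * ascProd a (k + 1) * a k := by
        rw [← ascProd_succ, ← ascProd_succ']
    _ = a 0 * ascProd a (k + 1) ^ 2 := by rw [hs]; simp only [mul_assoc]

/-- The full twist is central. -/
lemma commute_fullTwist (h : IsArtinSequence a (k + 1)) {i : ℕ} (hi : i ≤ k) :
    Commute (ascProd a (k + 1) ^ (k + 2)) (a i) := by
  have h₁ := h.semiconjBy_ascProd_pow (i := i) (j := k - i) (by omega)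
  have h₂ := h.semiconjBy_ascProd_pow (i := 0) (j := i) (by omega)
  rw [Nat.add_sub_cancel' hi] at h₁
  rw [zero_add] at h₂
  have h₃ := (h₂.mul_left h.semiconjBy_ascProd_sq).mul_left h₁
  rwa [← pow_add, ← pow_add, show i + 2 + (k - i) = k + 2 by omega] at h₃

lemma ascProd_mul_descProd_pow (h : IsArtinSequence a (k + 1)) (m : ℕ) :
    (ascProd a (k + 1) * descProd a (k + 1)) ^ m =
      (ascProd a (k + 1) ^ (k + 2)) ^ m *
        ascProd (fun i => a (i + 1)) k ^ (-((m * (k + 1) : ℕ) : ℤ)) := by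
  set ε := ascProd (fun i => a (i + 1)) k
  have hc : Commute (ascProd a (k + 1) ^ (k + 2)) ε := by
    refine Commute.list_prod_right _ _ fun x hx => ?_
    obtain ⟨i, hi, rfl⟩ := List.mem_map.1 hx
    exact h.commute_fullTwist (List.mem_range.1 hi)
  have hd : ascProd a (k + 1) * descProd a (k + 1)
      = ascProd a (k + 1) ^ (k + 2) * (ε ^ (k + 1))⁻¹ := by
    rw [pow_succ' _ (k + 1), h.ascProd_pow le_rfl, ← mul_assoc, mul_inv_cancel_right]
  rw [hd, (hc.pow_right _).inv_right.mul_pow, inv_pow, zpow_neg, zpow_natCast,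
    mul_comm m, pow_mul ε]

end IsArtinSequence

end ArtinSequence

lemma σ_commute {k : ℕ} {i j : Fin k} (hij : (i : ℕ) + 2 ≤ j) : Commute (σ i) (σ j) := by
  have h := PresentedGroup.one_of_mem (rels := braidRels k) (Or.inl ⟨i, j, hij, rfl⟩)
  simp only [map_mul, map_inv] at h
  exact mul_inv_eq_iff_eq_mul.1 (mul_inv_eq_one.1 h)

lemma σ_braid {k : ℕ} {i j : Fin k} (hij : (i : ℕ) + 1 = j) :
    σ i * σ j * σ i = σ j * σ i * σ j := by
  have h := PresentedGroup.one_of_mem (rels := braidRels k) (Or.inr ⟨i, j, hij, rfl⟩)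
  simp only [map_mul, map_inv] at h
  exact mul_inv_eq_one.1 h

/-- The Artin generators as a sequence, extended by `1`. -/
def σSeq (k i : ℕ) : BraidGroup k := if h : i < k then σ ⟨i, h⟩ else 1

lemma isArtinSequence_σSeq (k : ℕ) : IsArtinSequence (σSeq k) k where
  commute i j hij hj := by
    have hi : i < k := by omega
    simpa only [σSeq, hi, hj, dif_pos] using σ_commute hij
  braid i hi := by
    have hi' : i < k := by omega
    simpa only [σSeq, hi, hi', dif_pos] using σ_braid rfl

lemma ofFn_σ (k : ℕ) :
    (List.ofFn fun i : Fin k => σ i) = (List.range k).map (σSeq k) := by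
  refine List.ext_getElem (by simp) fun i h _ => ?_
  rw [List.length_ofFn] at h
  simp [σSeq, h]

lemma ofFn_σ_succ (k : ℕ) :
    (List.ofFn fun i : Fin k => σ i.succ) = (List.range k).map fun i => σSeq (k + 1) (i + 1) := by
  refine List.ext_getElem (by simp) fun i h _ => ?_
  rw [List.length_ofFn] at h
  simp [σSeq, h]

/-- In `Bₙ` (`n ≥ 2`), for positive integers `m`, the braid
`β_{n,m} = (δ δ^Δ)^{m−1} δ`, where `δ = a₁ ⋯ a_{n−1}` and `δ^Δ = a_{n−1} ⋯ a₁`,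
equals `Δ^{2m−2} · (a₂ ⋯ a_{n−1})^{−(m−1)(n−1)} · δ`, where `Δ² = δⁿ`. -/
theorem beta_nm_normal_form (n m : ℕ) (hn : 2 ≤ n) (hm : 1 ≤ m) :
    (((List.ofFn fun i : Fin (n - 1) => σ i).prod *
        ((List.ofFn fun i : Fin (n - 1) => σ i).reverse).prod) ^ (m - 1)) *
      (List.ofFn fun i : Fin (n - 1) => σ i).prod
    = (((List.ofFn fun i : Fin (n - 1) => σ i).prod) ^ n) ^ (m - 1) *
      ((List.ofFn fun i : Fin (n - 2) =>
          σ (Fin.castLE (by omega) i.succ)).prod) ^ (-(((m - 1) * (n - 1) : ℕ) : ℤ)) *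
      (List.ofFn fun i : Fin (n - 1) => σ i).prod := by
  obtain ⟨k, rfl⟩ := Nat.exists_eq_add_of_le' hn
  have h := (isArtinSequence_σSeq (k + 1)).ascProd_mul_descProd_pow (m - 1)
  simp only [ascProd, descProd, ← ofFn_σ, ← ofFn_σ_succ] at h
  exact congrArg (· * _) h
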